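/- arXiv:2003.11299 — 5 statements merged into one kernel-verified Lean document; each statement's English description precedes it below -/
import Mathlib

section
/- One has the matrix identity (D⁻)⁻¹ · (U⁺)ᵀ · U⁺ · D⁺ = J, where J is the r×r matrix with J_{1,1} = 1, with J_{2j,2j+1} = 1 and J_{2j+1,2j} = −1 for every integer j ≥ 1 with 2j+1 ≤ r, with J_{r,r} = 1 if r is even, and with all other entries equal to 0. (This is the lower-right r×r block of the jump matrix of the Riemann–Hilbert problem for X on the positive real axis.) -/
open Matrix Complex

/-- `Ω = exp(2πi/r)`. -/
noncomputable def Omega (r : ℕ) : ℂ := Complex.exp (2 * Real.pi * Complex.I / r)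

/-- The `r × r` matrix `U⁺` with (1-based) entries
`U⁺_{i,c} = r^{-1/2}·Ω^{(i−1)·(c/2)}` for even `c`, and
`U⁺_{i,c} = r^{-1/2}·Ω^{−(i−1)·((c−1)/2)}` for odd `c`. -/
noncomputable def Uplus (r : ℕ) : Matrix (Fin r) (Fin r) ℂ := fun i c =>
  (1 / Real.sqrt r) *
    (if (c.val + 1) % 2 = 0
      then Omega r ^ ((i.val : ℤ) * (((c.val + 1) / 2 : ℕ) : ℤ))
      else Omega r ^ (-((i.val : ℤ) * ((c.val / 2 : ℕ) : ℤ))))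

/-- `U⁻` is the entrywise complex conjugate of `U⁺`. -/
noncomputable def Uminus (r : ℕ) : Matrix (Fin r) (Fin r) ℂ :=
  (Uplus r).map (starRingEnd ℂ)

/-- Diagonal entry of `D⁺` at the (zero-based) index `k`:
`D⁺_{1,1} = 1`, `D⁺_{2j,2j} = (−1)^{j−1}·exp(πij/r)`,
`D⁺_{2j+1,2j+1} = (−1)^{j}·exp(−πij/r)` (1-based indexing). -/
noncomputable def DplusEntry (r k : ℕ) : ℂ :=
  if k = 0 then 1
  else if k % 2 = 1 then
    (-1 : ℂ) ^ ((k + 1) / 2 - 1) *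
      Complex.exp (Real.pi * Complex.I * (((k + 1) / 2 : ℕ) : ℂ) / r)
  else
    (-1 : ℂ) ^ (k / 2) *
      Complex.exp (-(Real.pi * Complex.I * ((k / 2 : ℕ) : ℂ) / r))

/-- Diagonal entry of `D⁻` at the (zero-based) index `k`:
`D⁻_{1,1} = 1`, `D⁻_{2j,2j} = (−1)^{j}·exp(−πij/r)`,
`D⁻_{2j+1,2j+1} = (−1)^{j}·exp(πij/r)` (1-based indexing). -/
noncomputable def DminusEntry (r k : ℕ) : ℂ :=
  if k = 0 then 1
  else if k % 2 = 1 then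
    (-1 : ℂ) ^ ((k + 1) / 2) *
      Complex.exp (-(Real.pi * Complex.I * (((k + 1) / 2 : ℕ) : ℂ) / r))
  else
    (-1 : ℂ) ^ (k / 2) *
      Complex.exp (Real.pi * Complex.I * ((k / 2 : ℕ) : ℂ) / r)

noncomputable def Dplus (r : ℕ) : Matrix (Fin r) (Fin r) ℂ :=
  Matrix.diagonal fun k => DplusEntry r k.val

noncomputable def Dminus (r : ℕ) : Matrix (Fin r) (Fin r) ℂ :=
  Matrix.diagonal fun k => DminusEntry r k.val

/-- The matrix `J` (1-based indexing): `J_{1,1} = 1`, `J_{2j,2j+1} = 1` and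
`J_{2j+1,2j} = −1` for `j ≥ 1` with `2j+1 ≤ r`, `J_{r,r} = 1` if `r` is even,
all other entries `0`.  (Zero-based in `Fin r`.) -/
noncomputable def Jmat (r : ℕ) : Matrix (Fin r) (Fin r) ℂ := fun a b =>
  if a.val = 0 ∧ b.val = 0 then 1
  else if r % 2 = 0 ∧ a.val = r - 1 ∧ b.val = r - 1 then 1
  else if a.val % 2 = 1 ∧ b.val = a.val + 1 then 1
  else if a.val % 2 = 0 ∧ b.val + 1 = a.val then -1
  else 0

/-- The exponent `e` with `U⁺_{i,k} = r^{-1/2}·Ω^{i·e}`, in zero-based indexing. -/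
def colExponent (k : ℕ) : ℤ := if k % 2 = 1 then ((k + 1) / 2 : ℕ) else -((k / 2 : ℕ) : ℤ)

theorem Uplus_apply (r : ℕ) (i c : Fin r) :
    Uplus r i c = (1 / Real.sqrt r) * Omega r ^ ((i.val : ℤ) * colExponent c) := by
  unfold Uplus colExponent
  by_cases h : c.val % 2 = 1
  · rw [if_pos (by omega), if_pos h]
  · rw [if_neg (by omega), if_neg h, mul_neg]

theorem DplusEntry_eq (r k : ℕ) :
    DplusEntry r k = (-1) ^ (k / 2) * exp (Real.pi * I * colExponent k / r) := by
  unfold DplusEntry colExponent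
  by_cases h0 : k = 0
  · simp [h0]
  by_cases h : k % 2 = 1
  · rw [if_neg h0, if_pos h, if_pos h, show (k + 1) / 2 - 1 = k / 2 by omega, Int.cast_natCast]
  · rw [if_neg h0, if_neg h, if_neg h, Int.cast_neg, Int.cast_natCast, mul_neg, neg_div]

theorem DminusEntry_eq (r k : ℕ) :
    DminusEntry r k = (-1) ^ (k / 2 + k) * exp (-(Real.pi * I * colExponent k / r)) := by
  unfold DminusEntry colExponent
  by_cases h0 : k = 0
  · simp [h0]
  by_cases h : k % 2 = 1
  · rw [if_neg h0, if_pos h, if_pos h, Int.cast_natCast,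
      neg_one_pow_congr (show Even ((k + 1) / 2) ↔ Even (k / 2 + k) by grind)]
  · rw [if_neg h0, if_neg h, if_neg h, Int.cast_neg, Int.cast_natCast, mul_neg, neg_div, neg_neg,
      neg_one_pow_congr (show Even (k / 2) ↔ Even (k / 2 + k) by grind)]

theorem DminusEntry_ne_zero (r k : ℕ) : DminusEntry r k ≠ 0 := by
  rw [DminusEntry_eq]
  exact mul_ne_zero (pow_ne_zero _ (by norm_num)) (exp_ne_zero _)

theorem DminusEntry_inv (r k : ℕ) :
    (DminusEntry r k)⁻¹ = (-1) ^ (k / 2 + k) * exp (Real.pi * I * colExponent k / r) := by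
  rw [DminusEntry_eq, mul_inv, ← exp_neg, neg_neg, ← inv_pow, inv_neg_one]

theorem Dminus_inv (r : ℕ) :
    (Dminus r)⁻¹ = diagonal fun k : Fin r => (DminusEntry r k)⁻¹ := by
  apply Matrix.inv_eq_left_inv
  rw [Dminus, diagonal_mul_diagonal, ← diagonal_one]
  congr 1
  funext k
  exact inv_mul_cancel₀ (DminusEntry_ne_zero r k)

theorem sum_Omega_zpow (r : ℕ) (hr : 0 < r) (n : ℤ) :
    ∑ i : Fin r, Omega r ^ ((i.val : ℤ) * n) = if (r : ℤ) ∣ n then (r : ℂ) else 0 := by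
  have hprim : IsPrimitiveRoot (Omega r) r := Complex.isPrimitiveRoot_exp r hr.ne'
  have hpow (i : ℕ) : Omega r ^ ((i : ℤ) * n) = (Omega r ^ n) ^ i := by
    rw [mul_comm, _root_.zpow_mul, zpow_natCast]
  simp only [hpow]
  rw [Fin.sum_univ_eq_sum_range (fun i => (Omega r ^ n) ^ i) r]
  split_ifs with h
  · simp [(hprim.zpow_eq_one_iff_dvd n).2 h]
  · have hne : Omega r ^ n ≠ 1 := mt (hprim.zpow_eq_one_iff_dvd n).1 h
    rw [geom_sum_eq hne, ← hpow, (hprim.zpow_eq_one_iff_dvd _).2 (dvd_mul_right _ _), sub_self,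
      zero_div]

theorem Uplus_transpose_mul_self_apply (r : ℕ) (hr : 0 < r) (a b : Fin r) :
    ((Uplus r)ᵀ * Uplus r) a b =
      if (r : ℤ) ∣ colExponent a + colExponent b then 1 else 0 := by
  have hr0 : (r : ℂ) ≠ 0 := Nat.cast_ne_zero.2 hr.ne'
  have hsq : (1 / (Real.sqrt r : ℂ)) * (1 / (Real.sqrt r : ℂ)) = 1 / r := by
    rw [div_mul_div_comm, one_mul, ← ofReal_mul, Real.mul_self_sqrt (Nat.cast_nonneg r),
      ofReal_natCast]
  have hterm (i : Fin r) : (Uplus r)ᵀ a i * Uplus r i b =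
      1 / r * Omega r ^ ((i.val : ℤ) * (colExponent a + colExponent b)) := by
    rw [transpose_apply, Uplus_apply, Uplus_apply, mul_mul_mul_comm, hsq, mul_add,
      zpow_add₀ (show Omega r ≠ 0 from exp_ne_zero _)]
  rw [mul_apply, Finset.sum_congr rfl fun i _ => hterm i, ← Finset.mul_sum, sum_Omega_zpow r hr]
  split_ifs
  · rw [one_div, inv_mul_cancel₀ hr0]
  · rw [mul_zero]

theorem dvd_colExponent_add_iff {r a b : ℕ} (ha : a < r) (hb : b < r) :
    (r : ℤ) ∣ colExponent a + colExponent b ↔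
      colExponent a + colExponent b = 0 ∨ colExponent a + colExponent b = r := by
  constructor
  · rintro ⟨m, hm⟩
    have hlo : -(r : ℤ) < colExponent a + colExponent b := by unfold colExponent; grind
    have hhi : colExponent a + colExponent b ≤ r := by unfold colExponent; grind
    have hm0 : -1 < m := by nlinarith
    have hm1 : m < 2 := by nlinarith
    interval_cases m <;> simp [hm]
  · rintro (h | h) <;> simp [h]

/-- `(D⁻)⁻¹ · (U⁺)ᵀ · U⁺ · D⁺ = J`: the jump of the RHP for `X` on `(0,∞)`. -/
theorem jump_positive_axis (r : ℕ) (hr : 0 < r) :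
    (Dminus r)⁻¹ * (Uplus r)ᵀ * Uplus r * Dplus r = Jmat r := by
  ext a b
  have hr0 : (r : ℂ) ≠ 0 := Nat.cast_ne_zero.2 hr.ne'
  have ha := a.isLt
  have hb := b.isLt
  have hphase : (DminusEntry r a)⁻¹ * DplusEntry r b = (-1) ^ (a.val / 2 + a + b / 2) *
      exp (Real.pi * I * (colExponent a + colExponent b : ℤ) / r) := by
    rw [DminusEntry_inv, DplusEntry_eq, mul_mul_mul_comm, ← pow_add, ← exp_add, Int.cast_add,
      mul_add, add_div]
  rw [Matrix.mul_assoc (Dminus r)⁻¹, Dminus_inv, Dplus, mul_diagonal, diagonal_mul,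
    Uplus_transpose_mul_self_apply r hr, mul_right_comm, hphase]
  simp only [dvd_colExponent_add_iff ha hb]
  unfold Jmat
  by_cases h0 : colExponent a + colExponent b = 0
  · rw [if_pos (Or.inl h0), h0, Int.cast_zero, mul_zero, zero_div, exp_zero, mul_one, mul_one]
    unfold colExponent at h0
    split_ifs with h₁ h₂ h₃ h₄
    · simp [h₁]
    · grind
    · exact Even.neg_one_pow (by grind)
    · exact Odd.neg_one_pow (by grind)
    · grind
  by_cases h1 : colExponent a + colExponent b = r
  · rw [if_pos (Or.inr h1), h1, Int.cast_natCast, mul_div_cancel_right₀ _ hr0, exp_pi_mul_I]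
    unfold colExponent at h1
    rw [if_neg (by grind), if_pos (by grind), Odd.neg_one_pow (by grind)]
    norm_num
  · rw [if_neg (by tauto), mul_zero]
    unfold colExponent at h0 h1
    rw [if_neg (by grind), if_neg (by grind), if_neg (by grind), if_neg (by grind)]
end

section
/- Let r be a positive integer. For all integers k, l with 0 ≤ k ≤ r and 0 ≤ l ≤ r, the integer (−1)^{l−1}·(1 + 2⌊l/2⌋) + 2·(−1)^k·⌊(k+1)/2⌋ + 1 is divisible by 2(r+1) if and only if k = l. -/
/-- For `0 ≤ k, l ≤ r`, the integer
`(−1)^{l−1}·(1 + 2⌊l/2⌋) + 2·(−1)^k·⌊(k+1)/2⌋ + 1`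
is divisible by `2(r+1)` if and only if `k = l`.
(`(−1)^{l−1}` is written as `(−1)^{l+1}`, to which it is equal.) -/
theorem divisibility_iff_eq (r : ℕ) (hr : 0 < r) (k l : ℕ) (hk : k ≤ r) (hl : l ≤ r) :
    (2 * ((r : ℤ) + 1)) ∣
        ((-1 : ℤ) ^ (l + 1) * (1 + 2 * ((l / 2 : ℕ) : ℤ))
          + 2 * (-1 : ℤ) ^ k * (((k + 1) / 2 : ℕ) : ℤ) + 1)
      ↔ k = l := by
  -- The expression has absolute value below `2 * (r + 1)`, so divisibility forces it to vanish.
  have eq_zero_iff {m x : ℤ} (hx : |x| < m) : m ∣ x ↔ x = 0 :=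
    ⟨fun h => Int.eq_zero_of_abs_lt_dvd h hx, fun h => h ▸ dvd_zero m⟩
  rcases Nat.even_or_odd' k with ⟨a, rfl | rfl⟩ <;>
  rcases Nat.even_or_odd' l with ⟨b, rfl | rfl⟩ <;>
  · simp only [pow_add, pow_mul, neg_one_sq, one_pow, pow_one, one_mul, mul_one, mul_neg, neg_mul,
      neg_neg]
    rw [eq_zero_iff (abs_lt.mpr (by omega))]
    omega
end

section
/- Let r be a positive integer, ζ = exp(πi/(r+1)), and let φ_0, …, φ_{r−1} be arbitrary complex numbers. For m = 1, …, r define F_m = −∑_{j=0}^{r−1} (∑_{k=0}^{j} ζ^{m·(2(−1)^k⌊(k+1)/2⌋ + 1)})·φ_j. Then for every integer l with 0 ≤ l ≤ r: ∑_{m=1}^{r} ζ^{m·(−1)^{l−1}(1+2⌊l/2⌋)}·F_m = ∑_{j=0}^{r−1} (j+1)·φ_j − (r+1)·∑_{j=l}^{r−1} φ_j. -/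
open Finset Complex

/-- `ζ = exp(πi/(r+1))`, a square root of `ω = exp(2πi/(r+1))`. -/
noncomputable def zetaRoot (r : ℕ) : ℂ := Complex.exp (Real.pi * Complex.I / (r + 1))

/-- The square of `zetaRoot r` is a primitive `(r+1)`-th root of unity. -/
theorem isPrimitiveRoot_zetaRoot_sq (r : ℕ) : IsPrimitiveRoot (zetaRoot r ^ 2) (r + 1) := by
  have h := Complex.isPrimitiveRoot_exp (r + 1) r.succ_ne_zero
  have e : zetaRoot r ^ 2 = Complex.exp (2 * Real.pi * Complex.I / ((r + 1 : ℕ) : ℂ)) := by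
    rw [zetaRoot, ← Complex.exp_nat_mul]
    congr 1
    push_cast
    ring
  rwa [e]

theorem zetaRoot_ne_zero (r : ℕ) : zetaRoot r ≠ 0 := Complex.exp_ne_zero _

/-- Power sum over the nonzero residues of an integral power of a primitive root of unity. -/
theorem IsPrimitiveRoot.sum_Icc_zpow_pow {K : Type*} [Field K] {w : K} {r : ℕ}
    (hw : IsPrimitiveRoot w (r + 1)) (d : ℤ) :
    ∑ m ∈ Finset.Icc 1 r, (w ^ d) ^ m = if ((r + 1 : ℕ) : ℤ) ∣ d then (r : K) else -1 := by
  split_ifs with hd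
  · simp [(hw.zpow_eq_one_iff_dvd d).2 hd]
  · have hne : w ^ d ≠ 1 := fun h => hd ((hw.zpow_eq_one_iff_dvd d).1 h)
    have hpow : (w ^ d) ^ (r + 1) = 1 := by
      rw [← zpow_natCast, ← zpow_mul, mul_comm, zpow_mul, zpow_natCast, hw.pow_eq_one, one_zpow]
    have hs : ∑ m ∈ Finset.range (r + 1), (w ^ d) ^ m = 0 := by
      rw [geom_sum_eq hne, hpow, sub_self, zero_div]
    rw [Finset.range_eq_Ico, Finset.sum_eq_sum_Ico_succ_bot r.succ_pos, pow_zero] at hs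
    exact eq_neg_of_add_eq_zero_right hs

/-- The integers `0, -1, 1, -2, 2, …` with index at most `r` are distinct modulo `r + 1`. -/
theorem dvd_alternating_sub_iff {r k l : ℕ} (hk : k ≤ r) (hl : l ≤ r) :
    ((r + 1 : ℕ) : ℤ) ∣ (-1 : ℤ) ^ k * (((k + 1) / 2 : ℕ) : ℤ)
      - (-1 : ℤ) ^ l * (((l + 1) / 2 : ℕ) : ℤ) ↔ k = l := by
  refine ⟨fun h => ?_, fun h => by simp [h]⟩
  have habs := Int.eq_zero_of_abs_lt_dvd h
  rcases Nat.even_or_odd k with hk' | hk' <;> rcases Nat.even_or_odd l with hl' | hl' <;>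
    simp only [hk'.neg_one_pow, hl'.neg_one_pow, abs_lt] at habs <;>
    simp only [Nat.even_iff, Nat.odd_iff] at hk' hl' <;> omega

/-- The two exponents of the identity combine to an even integer. -/
theorem alternating_exponent_add (k l : ℕ) :
    (-1 : ℤ) ^ (l + 1) * (1 + 2 * ((l / 2 : ℕ) : ℤ))
      + (2 * (-1 : ℤ) ^ k * (((k + 1) / 2 : ℕ) : ℤ) + 1)
      = 2 * ((-1 : ℤ) ^ k * (((k + 1) / 2 : ℕ) : ℤ) - (-1 : ℤ) ^ l * (((l + 1) / 2 : ℕ) : ℤ)) := by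
  have h : (-1 : ℤ) ^ l * (1 + 2 * ((l / 2 : ℕ) : ℤ))
      = 2 * ((-1 : ℤ) ^ l * (((l + 1) / 2 : ℕ) : ℤ)) + 1 := by
    rcases Nat.even_or_odd l with h | h
    · rw [h.neg_one_pow]
      rw [Nat.even_iff] at h
      omega
    · rw [h.neg_one_pow]
      rw [Nat.odd_iff] at h
      omega
  rw [pow_succ]
  linarith

/-- Orthogonality of the powers of `zetaRoot r` occurring in the identity. -/
theorem sum_zetaRoot_zpow_mul {r k l : ℕ} (hk : k ≤ r) (hl : l ≤ r) :
    ∑ m ∈ Finset.Icc 1 r,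
        zetaRoot r ^ ((m : ℤ) * ((-1 : ℤ) ^ (l + 1) * (1 + 2 * ((l / 2 : ℕ) : ℤ))))
          * zetaRoot r ^ ((m : ℤ) * (2 * (-1 : ℤ) ^ k * (((k + 1) / 2 : ℕ) : ℤ) + 1))
      = (if k = l then (r : ℂ) + 1 else 0) - 1 := by
  have h := (isPrimitiveRoot_zetaRoot_sq r).sum_Icc_zpow_pow
    ((-1 : ℤ) ^ k * (((k + 1) / 2 : ℕ) : ℤ) - (-1 : ℤ) ^ l * (((l + 1) / 2 : ℕ) : ℤ))
  simp only [dvd_alternating_sub_iff hk hl] at h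
  trans if k = l then (r : ℂ) else -1
  · rw [← h]
    refine Finset.sum_congr rfl fun m _ => ?_
    rw [← zpow_add₀ (zetaRoot_ne_zero r), ← mul_add, alternating_exponent_add, mul_comm, zpow_mul,
      zpow_mul, zpow_natCast, zpow_ofNat]
  · split_ifs <;> ring

/-- With `F_m = −∑_{j=0}^{r−1} (∑_{k=0}^{j} ζ^{m(2(−1)^k⌊(k+1)/2⌋+1)})·φ_j`,
for every `0 ≤ l ≤ r`:
`∑_{m=1}^{r} ζ^{m·(−1)^{l−1}(1+2⌊l/2⌋)}·F_m
  = ∑_{j=0}^{r−1} (j+1)·φ_j − (r+1)·∑_{j=l}^{r−1} φ_j`.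
(`(−1)^{l−1}` is written as `(−1)^{l+1}`, to which it is equal.) -/
theorem zeta_linear_identity (r : ℕ) (hr : 0 < r) (φ : ℕ → ℂ) (F : ℕ → ℂ)
    (hF : ∀ m : ℕ, F m =
      -∑ j ∈ Finset.range r,
          (∑ k ∈ Finset.range (j + 1),
            zetaRoot r ^ ((m : ℤ) * (2 * (-1 : ℤ) ^ k * (((k + 1) / 2 : ℕ) : ℤ) + 1)))
            * φ j)
    (l : ℕ) (hl : l ≤ r) :
    ∑ m ∈ Finset.Icc 1 r,
        zetaRoot r ^ ((m : ℤ) * ((-1 : ℤ) ^ (l + 1) * (1 + 2 * ((l / 2 : ℕ) : ℤ)))) * F m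
      = (∑ j ∈ Finset.range r, ((j : ℂ) + 1) * φ j)
          - ((r : ℂ) + 1) * ∑ j ∈ Finset.Ico l r, φ j := by
  simp only [hF, mul_neg, Finset.sum_neg_distrib, Finset.mul_sum, Finset.sum_mul]
  rw [Finset.sum_comm]
  have hcoeff : ∀ j ∈ Finset.range r,
      ∑ m ∈ Finset.Icc 1 r, ∑ k ∈ Finset.range (j + 1),
        zetaRoot r ^ ((m : ℤ) * ((-1 : ℤ) ^ (l + 1) * (1 + 2 * ((l / 2 : ℕ) : ℤ))))
          * (zetaRoot r ^ ((m : ℤ) * (2 * (-1 : ℤ) ^ k * (((k + 1) / 2 : ℕ) : ℤ) + 1)) * φ j)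
      = (if l ≤ j then ((r : ℂ) + 1) * φ j else 0) - ((j : ℂ) + 1) * φ j := by
    intro j hj
    rw [Finset.mem_range] at hj
    rw [Finset.sum_comm]
    simp only [← mul_assoc (zetaRoot r ^ (_ : ℤ)), ← Finset.sum_mul]
    rw [Finset.sum_congr rfl fun k hk =>
      sum_zetaRoot_zpow_mul (by rw [Finset.mem_range] at hk; omega) hl]
    rw [Finset.sum_sub_distrib, Finset.sum_ite_eq']
    simp only [Finset.mem_range, Nat.lt_succ_iff, Finset.sum_const, Finset.card_range, nsmul_eq_mul]
    push_cast
    split_ifs <;> ring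
  have hfilter : (Finset.range r).filter (fun j => l ≤ j) = Finset.Ico l r := by
    ext j
    simp [and_comm]
  rw [Finset.sum_congr rfl hcoeff, Finset.sum_sub_distrib, ← Finset.sum_filter, hfilter,
    ← Finset.mul_sum]
  ring
end

section
/- For all j, l ∈ {1, …, r+1}: 2(r+1) divides K_l − K_j − 2 if and only if (−1)^l·⌊l/2⌋ − (−1)^j·⌊j/2⌋ ≡ 1 (mod r+1). Moreover, for every j ∈ {1,…,r+1} there exists exactly one l ∈ {1,…,r+1} such that 2(r+1) divides K_l − K_j − 2. -/
/-- `K_j = (−1)^{j−1}·(r − 2·⌊(j−1)/2⌋)` for `j = 1,…,r+1`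
(twice the half-integers `k_j = (−1)^{j−1}(r/2 − ⌊(j−1)/2⌋)` of the paper). -/
def Kcoef (r j : ℕ) : ℤ := (-1 : ℤ) ^ (j - 1) * ((r : ℤ) - 2 * (((j - 1) / 2 : ℕ) : ℤ))

/-- The integer `(-1)^k ⌊k/2⌋`; it enumerates `0, 1, -1, 2, -2, …` for `k = 1, 2, 3, 4, 5, …`. -/
def signedHalf (k : ℕ) : ℤ := (-1 : ℤ) ^ k * ((k / 2 : ℕ) : ℤ)

theorem signedHalf_two_mul (a : ℕ) : signedHalf (2 * a) = a := by
  simp [signedHalf, pow_mul]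

theorem signedHalf_two_mul_add_one (a : ℕ) : signedHalf (2 * a + 1) = -a := by
  have h : (2 * a + 1) / 2 = a := by omega
  simp [signedHalf, pow_succ, pow_mul, h]

theorem signedHalf_eq_or (k : ℕ) :
    (2 * signedHalf k = k ∧ k % 2 = 0) ∨ (2 * signedHalf k = 1 - k ∧ k % 2 = 1) := by
  obtain ⟨a, rfl | rfl⟩ := Nat.even_or_odd' k
  · rw [signedHalf_two_mul]; omega
  · rw [signedHalf_two_mul_add_one]; omega

/-- `K_j ≡ r + 2 (-1)^j ⌊j/2⌋` modulo `2(r+1)`. -/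
theorem Kcoef_eq (r : ℕ) {j : ℕ} (hj : 1 ≤ j) :
    ∃ c : ℤ, Kcoef r j = r + 2 * signedHalf j + 2 * ((r : ℤ) + 1) * c := by
  obtain ⟨a, rfl | rfl⟩ := Nat.even_or_odd' j
  · obtain ⟨b, rfl⟩ : ∃ b, a = b + 1 := ⟨a - 1, by omega⟩
    have h1 : 2 * (b + 1) - 1 = 2 * b + 1 := by omega
    have h2 : (2 * b + 1) / 2 = b := by omega
    refine ⟨-1, ?_⟩
    rw [signedHalf_two_mul, Kcoef, h1, h2, pow_succ, pow_mul]
    push_cast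
    norm_num
    ring
  · refine ⟨0, ?_⟩
    rw [signedHalf_two_mul_add_one, Kcoef]
    simp [pow_mul]
    ring

theorem dvd_Kcoef_sub_iff (r : ℕ) {j l : ℕ} (hj : 1 ≤ j) (hl : 1 ≤ l) :
    2 * ((r : ℤ) + 1) ∣ Kcoef r l - Kcoef r j - 2 ↔
      (r : ℤ) + 1 ∣ signedHalf l - signedHalf j - 1 := by
  obtain ⟨c, hc⟩ := Kcoef_eq r hj
  obtain ⟨d, hd⟩ := Kcoef_eq r hl
  have h : Kcoef r l - Kcoef r j - 2 =
      2 * (signedHalf l - signedHalf j - 1) + 2 * ((r : ℤ) + 1) * (d - c) := by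
    rw [hc, hd]; ring
  rw [h, dvd_add_left (dvd_mul_right _ _)]
  exact mul_dvd_mul_iff_left two_ne_zero

theorem signedHalf_injOn_modulo {r k l : ℕ} (hk : 1 ≤ k) (hkr : k ≤ r + 1)
    (hl : 1 ≤ l) (hlr : l ≤ r + 1) (h : (r : ℤ) + 1 ∣ signedHalf k - signedHalf l) :
    k = l := by
  have hk' := signedHalf_eq_or k
  have hl' := signedHalf_eq_or l
  have h0 : signedHalf k - signedHalf l = 0 :=
    Int.eq_zero_of_abs_lt_dvd h (by rw [abs_lt]; omega)
  omega

theorem exists_signedHalf_eq {r : ℕ} {x : ℤ} (hx : -(r : ℤ) ≤ 2 * x) (hx' : 2 * x ≤ r + 1) :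
    ∃ l : ℕ, (1 ≤ l ∧ l ≤ r + 1) ∧ signedHalf l = x := by
  rcases lt_or_ge 0 x with h | h
  · lift x to ℕ using h.le
    exact ⟨2 * x, by omega, signedHalf_two_mul x⟩
  · obtain ⟨a, rfl⟩ := Int.exists_eq_neg_ofNat h
    exact ⟨2 * a + 1, by omega, signedHalf_two_mul_add_one a⟩

/-- For `j, l ∈ {1,…,r+1}`: `2(r+1) ∣ K_l − K_j − 2` iff
`(−1)^l⌊l/2⌋ − (−1)^j⌊j/2⌋ ≡ 1 (mod r+1)`; moreover for each such `j` there is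
exactly one such `l` with `2(r+1) ∣ K_l − K_j − 2`. -/
theorem Kcoef_congruence (r : ℕ) (hr : 0 < r) :
    (∀ j l : ℕ, 1 ≤ j → j ≤ r + 1 → 1 ≤ l → l ≤ r + 1 →
      ((2 * ((r : ℤ) + 1)) ∣ (Kcoef r l - Kcoef r j - 2) ↔
        (-1 : ℤ) ^ l * ((l / 2 : ℕ) : ℤ) - (-1 : ℤ) ^ j * ((j / 2 : ℕ) : ℤ)
          ≡ 1 [ZMOD ((r : ℤ) + 1)]))
    ∧ (∀ j : ℕ, 1 ≤ j → j ≤ r + 1 →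
        ∃! l : ℕ, (1 ≤ l ∧ l ≤ r + 1) ∧
          (2 * ((r : ℤ) + 1)) ∣ (Kcoef r l - Kcoef r j - 2)) := by
  refine ⟨fun j l hj _ hl _ => ?_, fun j hj hjr => ?_⟩
  · rw [dvd_Kcoef_sub_iff r hj hl]
    exact Int.modEq_iff_dvd.symm.trans Int.modEq_comm
  · have hj' := signedHalf_eq_or j
    obtain ⟨l, ⟨hl, hlr⟩, hdvd⟩ : ∃ l : ℕ, (1 ≤ l ∧ l ≤ r + 1) ∧
        (r : ℤ) + 1 ∣ signedHalf l - signedHalf j - 1 := by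
      by_cases h : 2 * (signedHalf j + 1) ≤ r + 1
      · obtain ⟨l, hl, hs⟩ := exists_signedHalf_eq (r := r) (x := signedHalf j + 1)
          (by omega) h
        exact ⟨l, hl, 0, by rw [hs]; ring⟩
      · obtain ⟨l, hl, hs⟩ := exists_signedHalf_eq (r := r) (x := signedHalf j - r)
          (by omega) (by omega)
        exact ⟨l, hl, -1, by rw [hs]; ring⟩
    refine ⟨l, ⟨⟨hl, hlr⟩, (dvd_Kcoef_sub_iff r hj hl).2 hdvd⟩, ?_⟩
    rintro k ⟨⟨hk, hkr⟩, hkdvd⟩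
    refine signedHalf_injOn_modulo hk hkr hl hlr ?_
    simpa using dvd_sub ((dvd_Kcoef_sub_iff r hj hk).1 hkdvd) hdvd
end

section
/- For all j, l ∈ {1, …, r+1}: 2(r+1) divides K_l − K_j − 2 if and only if exactly one of the following holds: (i) j = 1 and l = 2; (ii) j is odd, j ≥ 3, and l = j − 2; (iii) j is even, j ≤ r − 1, and l = j + 2; (iv) j is even, j ≥ r, and l = 2r + 1 − j. (In other words, the permutation of {1,…,r+1} determined by the condition 2(r+1) ∣ (K_l − K_j − 2) is the explicit composition of pair-swap permutations appearing in the paper.) -/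
theorem Kcoef_of_odd (r : ℕ) {j : ℕ} (hj : Odd j) : Kcoef r j = r + 1 - j := by
  obtain ⟨a, rfl⟩ := hj
  have h : 2 * a / 2 = a := by omega
  simp [Kcoef, h]

theorem Kcoef_of_even (r : ℕ) {j : ℕ} (hj : Even j) (h0 : 1 ≤ j) :
    Kcoef r j = j - 2 - r := by
  obtain ⟨a, rfl⟩ : ∃ a, j = 2 * a + 2 := ⟨j / 2 - 1, by grind⟩
  have h : (2 * a + 1) / 2 = a := by omega
  simp [Kcoef, h, pow_succ]

theorem dvd_iff_eq_zero_or_eq_neg {m x : ℤ} (h₁ : -(2 * m) < x) (h₂ : x < m) :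
    m ∣ x ↔ x = 0 ∨ x = -m := by
  constructor
  · rintro ⟨c, rfl⟩
    have hm : 0 < m := by linarith
    have hc₁ : -2 < c := by nlinarith
    have hc₂ : c < 1 := by nlinarith
    obtain rfl | rfl : c = 0 ∨ c = -1 := by omega
    · simp
    · simp
  · rintro (rfl | rfl) <;> simp

/-- For `j, l ∈ {1,…,r+1}`: `2(r+1) ∣ K_l − K_j − 2` holds iff exactly one of:
(i) `j = 1` and `l = 2`; (ii) `j` odd, `j ≥ 3`, `l = j−2`;
(iii) `j` even, `j ≤ r−1`, `l = j+2`; (iv) `j` even, `j ≥ r`, `l = 2r+1−j`. -/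
theorem Kcoef_permutation (r : ℕ) (hr : 0 < r) (j l : ℕ)
    (hj1 : 1 ≤ j) (hj2 : j ≤ r + 1) (hl1 : 1 ≤ l) (hl2 : l ≤ r + 1) :
    (2 * ((r : ℤ) + 1)) ∣ (Kcoef r l - Kcoef r j - 2) ↔
      (j = 1 ∧ l = 2)
      ∨ (Odd j ∧ 3 ≤ j ∧ l = j - 2)
      ∨ (Even j ∧ j ≤ r - 1 ∧ l = j + 2)
      ∨ (Even j ∧ r ≤ j ∧ l = 2 * r + 1 - j) := by
  rcases Nat.even_or_odd j with hj | hj <;> rcases Nat.even_or_odd l with hl | hl <;>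
    simp only [Kcoef_of_odd, Kcoef_of_even, hj, hl, hj1, hl1] <;>
    rw [dvd_iff_eq_zero_or_eq_neg (by omega) (by omega)] <;>
    simp only [Nat.even_iff, Nat.odd_iff, true_and] at hj hl ⊢ <;>
    omega
end
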